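/- Let N ≥ 2, m > 0, V₀ ∈ (0,m), and let V : ℝ^N → ℝ be continuous and bounded with V(y) + V₀ ≥ 0 for all y ∈ ℝ^N. Set Q(u) = ½∬_{ℝ^{N+1}_+}(|∇u|² + m²u²) dx dy + ½∫_{ℝ^N} V(y) u(0,y)² dy. Then, with K = min{½(1 − V₀/m), ½m(m − V₀)} > 0, one has K‖u‖² ≤ Q(u) for every smooth compactly supported u : ℝ × ℝ^N → ℝ, and there exists a constant C > 0 (depending on m and sup|V|) such that Q(u) ≤ C‖u‖² for every such u; here ‖u‖² = ∬_{ℝ^{N+1}_+}(|∇u|² + u²) dx dy. -/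

import Mathlib

open MeasureTheory Real Filter Set

noncomputable section

/-- The open half-space `ℝ^{N+1}_+ = (0,∞) × ℝ^N`. -/
def halfSpace (N : ℕ) : Set (ℝ × EuclideanSpace ℝ (Fin N)) := {p | 0 < p.1}

/-- Squared Euclidean norm of the full gradient of `u : ℝ × ℝ^N → ℝ` at `p`. -/
def gradSq {N : ℕ} (u : ℝ × EuclideanSpace ℝ (Fin N) → ℝ)
    (p : ℝ × EuclideanSpace ℝ (Fin N)) : ℝ :=
  (fderiv ℝ u p (1, 0)) ^ 2 +
    ∑ i : Fin N, (fderiv ℝ u p (0, EuclideanSpace.single i 1)) ^ 2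

/-- The square of the `H¹(ℝ^{N+1}_+)` norm: `‖u‖² = ∬_{ℝ^{N+1}_+} (|∇u|² + u²) dx dy`. -/
def hnormSq {N : ℕ} (u : ℝ × EuclideanSpace ℝ (Fin N) → ℝ) : ℝ :=
  ∫ p in halfSpace N, (gradSq u p + (u p) ^ 2)

/-- The quadratic form
`Q(u) = ½∬_{ℝ^{N+1}_+}(|∇u|² + m²u²) + ½∫_{ℝ^N} V(y) u(0,y)² dy`. -/
def quadForm {N : ℕ} (m : ℝ) (V : EuclideanSpace ℝ (Fin N) → ℝ)
    (u : ℝ × EuclideanSpace ℝ (Fin N) → ℝ) : ℝ :=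
  (1 / 2) * (∫ p in halfSpace N, (gradSq u p + m ^ 2 * (u p) ^ 2)) +
    (1 / 2) * ∫ y : EuclideanSpace ℝ (Fin N), V y * (u (0, y)) ^ 2

lemma HasCompactSupport.fun_sq {α : Type*} [TopologicalSpace α] {f : α → ℝ}
    (hf : HasCompactSupport f) : HasCompactSupport fun x => f x ^ 2 :=
  hf.comp_left (g := fun t : ℝ => t ^ 2) (by simp)

/-- Integrating `∂ₓ(u²)` along the normal direction recovers the boundary values of `u²`. -/
lemma integral_halfSpace_normal_deriv {N : ℕ} {u : ℝ × EuclideanSpace ℝ (Fin N) → ℝ}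
    (hu : ContDiff ℝ (⊤ : ℕ∞) u) (hc : HasCompactSupport u) :
    ∫ p in halfSpace N, 2 * u p * fderiv ℝ u p (1, 0) =
      -∫ y : EuclideanSpace ℝ (Fin N), u (0, y) ^ 2 := by
  have hcont : Continuous fun p => fderiv ℝ u p (1, 0) :=
    (hu.continuous_fderiv (by simp)).clm_apply continuous_const
  have hw : Integrable (fun p => 2 * u p * fderiv ℝ u p (1, 0)) :=
    ((continuous_const.mul hu.continuous).mul hcont).integrable_of_hasCompactSupport
      (hc.mul_left.mul_right)
  have hset : halfSpace N = Ioi (0 : ℝ) ×ˢ (univ : Set (EuclideanSpace ℝ (Fin N))) := by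
    ext p; simp [halfSpace]
  have hvol : (volume : Measure (ℝ × EuclideanSpace ℝ (Fin N))).restrict (halfSpace N) =
      ((volume : Measure ℝ).restrict (Ioi 0)).prod volume := by
    rw [hset, Measure.volume_eq_prod, ← Measure.prod_restrict, Measure.restrict_univ]
  have hw' := hw.restrict (s := halfSpace N)
  rw [hvol] at hw' ⊢
  rw [integral_prod_symm _ hw', ← integral_neg]
  congr 1
  ext y
  have hd : ∀ x : ℝ, HasDerivAt (fun x => u (x, y) ^ 2)
      (2 * u (x, y) * fderiv ℝ u (x, y) (1, 0)) x := by
    intro x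
    have h1 : HasDerivAt (fun x : ℝ => (x, y)) ((1 : ℝ), (0 : EuclideanSpace ℝ (Fin N))) x :=
      (hasDerivAt_id x).prodMk (hasDerivAt_const x y)
    have h2 := ((hu.differentiable (by simp) (x, y)).hasFDerivAt.comp_hasDerivAt x h1).fun_pow 2
    simpa using h2
  have hcs : HasCompactSupport fun x : ℝ => u (x, y) ^ 2 := by
    have : HasCompactSupport fun x : ℝ => u (x, y) :=
      hc.comp_isClosedEmbedding (Topology.IsClosedEmbedding.of_continuous_injective_isClosedMap
        (by fun_prop) (fun a b h => by simpa using h) (isClosedMap_prodMk_right y))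
    exact this.fun_sq
  have hc1 : ContDiff ℝ 1 fun x : ℝ => u (x, y) ^ 2 :=
    ((hu.of_le (by simp)).comp (contDiff_id.prodMk contDiff_const)).pow 2
  rw [← hcs.integral_Ioi_deriv_eq hc1 0]
  exact integral_congr_ae (Eventually.of_forall fun x => ((hd x).deriv).symm)

lemma continuous_gradSq {N : ℕ} {u : ℝ × EuclideanSpace ℝ (Fin N) → ℝ}
    (hu : ContDiff ℝ (⊤ : ℕ∞) u) : Continuous (gradSq u) := by
  have h : ∀ v, Continuous fun p => fderiv ℝ u p v := fun v =>
    (hu.continuous_fderiv (by simp)).clm_apply continuous_const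
  exact ((h _).pow 2).add (continuous_finsetSum _ fun i _ => (h _).pow 2)

lemma hasCompactSupport_gradSq {N : ℕ} {u : ℝ × EuclideanSpace ℝ (Fin N) → ℝ}
    (hc : HasCompactSupport u) : HasCompactSupport (gradSq u) :=
  (hc.fderiv ℝ).comp_left
    (g := fun L : ℝ × EuclideanSpace ℝ (Fin N) →L[ℝ] ℝ => L (1, 0) ^ 2 +
      ∑ i : Fin N, L (0, EuclideanSpace.single i 1) ^ 2) (by simp)

lemma integrable_gradSq {N : ℕ} {u : ℝ × EuclideanSpace ℝ (Fin N) → ℝ}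
    (hu : ContDiff ℝ (⊤ : ℕ∞) u) (hc : HasCompactSupport u) : Integrable (gradSq u) :=
  (continuous_gradSq hu).integrable_of_hasCompactSupport (hasCompactSupport_gradSq hc)

lemma integrable_sq_of_hasCompactSupport {N : ℕ} {u : ℝ × EuclideanSpace ℝ (Fin N) → ℝ}
    (hu : Continuous u) (hc : HasCompactSupport u) : Integrable fun p => u p ^ 2 :=
  (hu.pow 2).integrable_of_hasCompactSupport hc.fun_sq

lemma integrable_trace_sq {N : ℕ} {u : ℝ × EuclideanSpace ℝ (Fin N) → ℝ}
    (hu : Continuous u) (hc : HasCompactSupport u) :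
    Integrable fun y : EuclideanSpace ℝ (Fin N) => u (0, y) ^ 2 := by
  have h : HasCompactSupport fun y : EuclideanSpace ℝ (Fin N) => u (0, y) :=
    hc.comp_isClosedEmbedding (Topology.IsClosedEmbedding.of_continuous_injective_isClosedMap
      (by fun_prop) (fun a b h => by simpa using h) (isClosedMap_prodMk_left (0 : ℝ)))
  exact Continuous.integrable_of_hasCompactSupport (by fun_prop)
    h.fun_sq

/-- The trace inequality `∫ u(0,y)² dy ≤ m⁻¹ ∬ |∇u|² + m ∬ u²`. -/
lemma integral_trace_sq_le {N : ℕ} {u : ℝ × EuclideanSpace ℝ (Fin N) → ℝ} {m : ℝ} (hm : 0 < m)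
    (hu : ContDiff ℝ (⊤ : ℕ∞) u) (hc : HasCompactSupport u) :
    ∫ y : EuclideanSpace ℝ (Fin N), u (0, y) ^ 2 ≤
      m⁻¹ * (∫ p in halfSpace N, gradSq u p) + m * ∫ p in halfSpace N, u p ^ 2 := by
  have hG := (integrable_gradSq hu hc).integrableOn (s := halfSpace N)
  have hU := (integrable_sq_of_hasCompactSupport hu.continuous hc).integrableOn
    (s := halfSpace N)
  rw [← neg_neg (∫ y, _), ← integral_halfSpace_normal_deriv hu hc, ← integral_neg,
    ← integral_const_mul, ← integral_const_mul,
    ← integral_add (hG.const_mul _) (hU.const_mul _)]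
  have hcont : Continuous fun p => fderiv ℝ u p (1, 0) :=
    (hu.continuous_fderiv (by simp)).clm_apply continuous_const
  have hw : Integrable (fun p => 2 * u p * fderiv ℝ u p (1, 0)) :=
    ((continuous_const.mul hu.continuous).mul hcont).integrable_of_hasCompactSupport
      (hc.mul_left.mul_right)
  refine integral_mono hw.integrableOn.neg ((hG.const_mul _).add (hU.const_mul _)) fun p => ?_
  have hsum : 0 ≤ ∑ i : Fin N, fderiv ℝ u p (0, EuclideanSpace.single i 1) ^ 2 :=
    Finset.sum_nonneg fun i _ => sq_nonneg _
  have hsq : 0 ≤ m⁻¹ * (fderiv ℝ u p (1, 0) + m * u p) ^ 2 := by positivity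
  have hexp : m⁻¹ * (fderiv ℝ u p (1, 0) + m * u p) ^ 2 =
      m⁻¹ * fderiv ℝ u p (1, 0) ^ 2 + 2 * u p * fderiv ℝ u p (1, 0) + m * u p ^ 2 := by
    field_simp
    ring
  have hs : 0 ≤ m⁻¹ * ∑ i : Fin N, fderiv ℝ u p (0, EuclideanSpace.single i 1) ^ 2 := by
    positivity
  simp only [gradSq, mul_add]
  linarith

lemma integral_gradSq_add_const_mul_sq {N : ℕ} {u : ℝ × EuclideanSpace ℝ (Fin N) → ℝ}
    (hu : ContDiff ℝ (⊤ : ℕ∞) u) (hc : HasCompactSupport u) (a : ℝ) :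
    ∫ p in halfSpace N, (gradSq u p + a * u p ^ 2) =
      (∫ p in halfSpace N, gradSq u p) + a * ∫ p in halfSpace N, u p ^ 2 := by
  rw [integral_add (integrable_gradSq hu hc).integrableOn
    ((integrable_sq_of_hasCompactSupport hu.continuous hc).integrableOn.const_mul a),
    integral_const_mul]

lemma integral_gradSq_nonneg {N : ℕ} (u : ℝ × EuclideanSpace ℝ (Fin N) → ℝ) :
    0 ≤ ∫ p in halfSpace N, gradSq u p :=
  integral_nonneg fun _ => add_nonneg (sq_nonneg _) (Finset.sum_nonneg fun _ _ => sq_nonneg _)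

lemma hnormSq_eq {N : ℕ} {u : ℝ × EuclideanSpace ℝ (Fin N) → ℝ}
    (hu : ContDiff ℝ (⊤ : ℕ∞) u) (hc : HasCompactSupport u) :
    hnormSq u = (∫ p in halfSpace N, gradSq u p) + ∫ p in halfSpace N, u p ^ 2 := by
  simpa [hnormSq] using integral_gradSq_add_const_mul_sq hu hc 1

/-- With `N ≥ 2`, `0 < V₀ < m`, `V` continuous bounded with
`V + V₀ ≥ 0`: with `K = min{½(1 − V₀/m), ½m(m − V₀)} > 0` one has `K‖u‖² ≤ Q(u)` for all
smooth compactly supported `u`, and there is `C > 0` with `Q(u) ≤ C‖u‖²` for all such `u`. -/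
theorem statement11 (N : ℕ) (hN : 2 ≤ N) (m V₀ : ℝ) (hm : 0 < m)
    (hV₀ : 0 < V₀) (hV₀m : V₀ < m)
    (V : EuclideanSpace ℝ (Fin N) → ℝ) (hVc : Continuous V)
    (hVb : ∃ C : ℝ, ∀ y, |V y| ≤ C)
    (hVlow : ∀ y, 0 ≤ V y + V₀) :
    (0 < min ((1 / 2) * (1 - V₀ / m)) ((1 / 2) * (m * (m - V₀)))) ∧
    (∀ u : ℝ × EuclideanSpace ℝ (Fin N) → ℝ,
        ContDiff ℝ (⊤ : ℕ∞) u → HasCompactSupport u →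
        min ((1 / 2) * (1 - V₀ / m)) ((1 / 2) * (m * (m - V₀))) * hnormSq u ≤
          quadForm m V u) ∧
    ∃ C : ℝ, 0 < C ∧
      ∀ u : ℝ × EuclideanSpace ℝ (Fin N) → ℝ,
        ContDiff ℝ (⊤ : ℕ∞) u → HasCompactSupport u →
        quadForm m V u ≤ C * hnormSq u := by
  obtain ⟨C, hC⟩ := hVb
  have hC0 : 0 ≤ C := (abs_nonneg _).trans (hC 0)
  have hB (u : ℝ × EuclideanSpace ℝ (Fin N) → ℝ) : 0 ≤ ∫ p in halfSpace N, u p ^ 2 :=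
    integral_nonneg fun _ => sq_nonneg _
  have hVu (u : ℝ × EuclideanSpace ℝ (Fin N) → ℝ) (hu : ContDiff ℝ (⊤ : ℕ∞) u)
      (hc : HasCompactSupport u) :
      Integrable fun y : EuclideanSpace ℝ (Fin N) => V y * u (0, y) ^ 2 :=
    (integrable_trace_sq hu.continuous hc).bdd_mul hVc.aestronglyMeasurable
      (Eventually.of_forall fun y => hC y)
  refine ⟨?_, fun u hu hc => ?_, (1 + m ^ 2 + C * (m⁻¹ + m)) / 2, by positivity,
    fun u hu hc => ?_⟩
  · have h1 : V₀ / m < 1 := (div_lt_one hm).2 hV₀m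
    have h2 : 0 < m * (m - V₀) := mul_pos hm (sub_pos.2 hV₀m)
    exact lt_min (by linarith) (by linarith)
  · have hT := mul_le_mul_of_nonneg_left (integral_trace_sq_le hm hu hc) hV₀.le
    have hlow : -(V₀ * ∫ y : EuclideanSpace ℝ (Fin N), u (0, y) ^ 2) ≤
        ∫ y : EuclideanSpace ℝ (Fin N), V y * u (0, y) ^ 2 := by
      rw [← neg_mul, ← integral_const_mul]
      exact integral_mono ((integrable_trace_sq hu.continuous hc).const_mul _) (hVu u hu hc)
        fun y => mul_le_mul_of_nonneg_right (by linarith [hVlow y]) (sq_nonneg _)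
    rw [quadForm, hnormSq_eq hu hc, integral_gradSq_add_const_mul_sq hu hc, mul_add]
    have h1 := mul_le_mul_of_nonneg_right (min_le_left ((1 / 2) * (1 - V₀ / m))
      ((1 / 2) * (m * (m - V₀)))) (integral_gradSq_nonneg u)
    have h2 := mul_le_mul_of_nonneg_right (min_le_right ((1 / 2) * (1 - V₀ / m))
      ((1 / 2) * (m * (m - V₀)))) (hB u)
    rw [div_eq_mul_inv V₀ m] at *
    linarith
  · have hT := mul_le_mul_of_nonneg_left (integral_trace_sq_le hm hu hc) hC0
    have hup : ∫ y : EuclideanSpace ℝ (Fin N), V y * u (0, y) ^ 2 ≤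
        C * ∫ y : EuclideanSpace ℝ (Fin N), u (0, y) ^ 2 := by
      rw [← integral_const_mul]
      exact integral_mono (hVu u hu hc) ((integrable_trace_sq hu.continuous hc).const_mul _)
        fun y => mul_le_mul_of_nonneg_right ((le_abs_self _).trans (hC y)) (sq_nonneg _)
    rw [quadForm, hnormSq_eq hu hc, integral_gradSq_add_const_mul_sq hu hc]
    have hA := integral_gradSq_nonneg u
    have hB := hB u
    generalize (∫ p in halfSpace N, gradSq u p) = A at *
    generalize (∫ p in halfSpace N, u p ^ 2) = B at *
    have h1 : 0 ≤ m ^ 2 * A := by positivity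
    have h2 : 0 ≤ C * m * A := by positivity
    have h3 : 0 ≤ C * m⁻¹ * B := by positivity
    linarith

end
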